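/- arXiv:0911.2529 — 2 statements merged into one kernel-verified Lean document; each statement's English description precedes it below -/
import Mathlib

section
/- Let F be a field of characteristic not 2 and a₁ ∈ F with -a₁ a nonsquare. Over K = F(X₁,X₂,X₃,X₄), the matrix T = [[X₁, −a₁X₂, S₁₁, S₁₂],[X₂, X₁, S₂₁, S₂₂],[X₃, −a₁X₄, X₁, −a₁X₂],[X₄, X₃, X₂, X₁]], where S = (−a₂/(X₁²+a₁X₂²))·[[X₁²X₃ + 2a₁X₁X₂X₄ − a₁X₂²X₃, −2a₁X₁X₂X₃ − a₁²X₂²X₄ + a₁X₁²X₄],[2X₁X₂X₃ − X₁²X₄ + a₁X₂²X₄, X₁²X₃ − a₁X₂²X₃ + 2a₁X₁X₂X₄]], satisfies φ(T·Y) = φ(X₁,X₂,X₃,X₄)·φ(Y) for all Y ∈ K⁴, where φ(y₁,y₂,y₃,y₄) = y₁² + a₁y₂² + a₂y₃² + a₁a₂y₄². -/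
open Matrix

theorem pfister_aux {K : Type*} [Field K] (a b x y z w p q r t : K)
    (h : x ^ 2 + a * y ^ 2 ≠ 0) :
    (x * p + -a * y * q
      + -b / (x ^ 2 + a * y ^ 2) * (x ^ 2 * z + 2 * a * x * y * w - a * y ^ 2 * z) * r
      + -b / (x ^ 2 + a * y ^ 2) *
        (-(2 * a * x * y * z) - a ^ 2 * y ^ 2 * w + a * x ^ 2 * w) * t) ^ 2
    + a * (y * p + x * q
      + -b / (x ^ 2 + a * y ^ 2) * (2 * x * y * z - x ^ 2 * w + a * y ^ 2 * w) * r
      + -b / (x ^ 2 + a * y ^ 2) *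
        (x ^ 2 * z - a * y ^ 2 * z + 2 * a * x * y * w) * t) ^ 2
    + b * (z * p + -a * w * q + x * r + -a * y * t) ^ 2
    + a * b * (w * p + z * q + y * r + x * t) ^ 2
    = (x ^ 2 + a * y ^ 2 + b * z ^ 2 + a * b * w ^ 2) *
      (p ^ 2 + a * q ^ 2 + b * r ^ 2 + a * b * t ^ 2) := by
  field_simp
  ring

theorem denom_ne {F : Type*} [Field F] (a : F) :
    (algebraMap (MvPolynomial (Fin 4) F) (FractionRing (MvPolynomial (Fin 4) F))
        (MvPolynomial.X 0)) ^ 2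
      + algebraMap F (FractionRing (MvPolynomial (Fin 4) F)) a *
      (algebraMap (MvPolynomial (Fin 4) F) (FractionRing (MvPolynomial (Fin 4) F))
        (MvPolynomial.X 1)) ^ 2 ≠ 0 := by
  rw [IsScalarTower.algebraMap_apply F (MvPolynomial (Fin 4) F)
    (FractionRing (MvPolynomial (Fin 4) F)), ← map_pow, ← map_pow, ← map_mul, ← map_add]
  intro h
  have h' := (map_eq_zero_iff _ (IsFractionRing.injective (MvPolynomial (Fin 4) F)
    (FractionRing (MvPolynomial (Fin 4) F)))).1 h
  have := congrArg (MvPolynomial.eval (fun i : Fin 4 => if i = 0 then (1 : F) else 0)) h'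
  simp [MvPolynomial.algebraMap_eq] at this

/-- Over `K = F(X₁,X₂,X₃,X₄)`, the explicit Pfister matrix `T` (with the block `S`
given by the displayed formulas) satisfies `φ(T·Y) = φ(X₁,X₂,X₃,X₄)·φ(Y)` for all
`Y ∈ K⁴`, where `φ(y) = y₁² + a₁y₂² + a₂y₃² + a₁a₂y₄²`. -/
theorem stmt_10 (F : Type*) [Field F] (h2 : (1 : F) + 1 ≠ 0)
    (a₁ a₂ : F) (hns : ∀ y : F, y ^ 2 ≠ -a₁) (ha₁ : a₁ ≠ 0) (ha₂ : a₂ ≠ 0) :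
    let K := FractionRing (MvPolynomial (Fin 4) F)
    let X : Fin 4 → K := fun i =>
      algebraMap (MvPolynomial (Fin 4) F) K (MvPolynomial.X i)
    let A₁ : K := algebraMap F K a₁
    let A₂ : K := algebraMap F K a₂
    let c : K := -A₂ / (X 0 ^ 2 + A₁ * X 1 ^ 2)
    let S : Matrix (Fin 2) (Fin 2) K :=
      c • !![X 0 ^ 2 * X 2 + 2 * A₁ * X 0 * X 1 * X 3 - A₁ * X 1 ^ 2 * X 2,
             -(2 * A₁ * X 0 * X 1 * X 2) - A₁ ^ 2 * X 1 ^ 2 * X 3 + A₁ * X 0 ^ 2 * X 3;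
             2 * X 0 * X 1 * X 2 - X 0 ^ 2 * X 3 + A₁ * X 1 ^ 2 * X 3,
             X 0 ^ 2 * X 2 - A₁ * X 1 ^ 2 * X 2 + 2 * A₁ * X 0 * X 1 * X 3]
    let T : Matrix (Fin 4) (Fin 4) K :=
      !![X 0, -A₁ * X 1, S 0 0, S 0 1;
         X 1, X 0,       S 1 0, S 1 1;
         X 2, -A₁ * X 3, X 0,   -A₁ * X 1;
         X 3, X 2,       X 1,   X 0]
    let φ : (Fin 4 → K) → K := fun v =>
      v 0 ^ 2 + A₁ * v 1 ^ 2 + A₂ * v 2 ^ 2 + A₁ * A₂ * v 3 ^ 2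
    ∀ Y : Fin 4 → K,
      φ (T.mulVec Y) = (X 0 ^ 2 + A₁ * X 1 ^ 2 + A₂ * X 2 ^ 2 + A₁ * A₂ * X 3 ^ 2) * φ Y := by
  intro K X A₁ A₂ c S T φ Y
  have key := pfister_aux A₁ A₂ (X 0) (X 1) (X 2) (X 3) (Y 0) (Y 1) (Y 2) (Y 3) (denom_ne a₁)
  have e0 : T.mulVec Y 0 = X 0 * Y 0 + -A₁ * X 1 * Y 1 + S 0 0 * Y 2 + S 0 1 * Y 3 := by
    simp only [Matrix.mulVec, dotProduct, Fin.sum_univ_four]; rfl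
  have e1 : T.mulVec Y 1 = X 1 * Y 0 + X 0 * Y 1 + S 1 0 * Y 2 + S 1 1 * Y 3 := by
    simp only [Matrix.mulVec, dotProduct, Fin.sum_univ_four]; rfl
  have e2 : T.mulVec Y 2 = X 2 * Y 0 + -A₁ * X 3 * Y 1 + X 0 * Y 2 + -A₁ * X 1 * Y 3 := by
    simp only [Matrix.mulVec, dotProduct, Fin.sum_univ_four]; rfl
  have e3 : T.mulVec Y 3 = X 3 * Y 0 + X 2 * Y 1 + X 1 * Y 2 + X 0 * Y 3 := by
    simp only [Matrix.mulVec, dotProduct, Fin.sum_univ_four]; rfl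
  change T.mulVec Y 0 ^ 2 + A₁ * T.mulVec Y 1 ^ 2 + A₂ * T.mulVec Y 2 ^ 2
    + A₁ * A₂ * T.mulVec Y 3 ^ 2 = _
  rw [e0, e1, e2, e3]
  exact key
end

section
/- Let F be a field of characteristic not 2, a₁,…,aₙ ∈ F, K = F(X₁,…,X_{2ⁿ}), and suppose the n-fold Pfister form φ = ⟨1,a₁⟩⊗⋯⊗⟨1,aₙ⟩ is anisotropic over F. With ψᵢ, ψ̂ᵢ as the values of the i-fold subforms at the first/next 2ⁱ variables, the elements −a₁, −a₂·ψ̂₁/ψ₁, …, −aₙ·ψ̂_{n−1}/ψ_{n−1} generate a multiquadratic extension L of K of degree 2ⁿ, i.e., these n elements are independent modulo squares in K. -/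
/-- `pfisterVal a i v` is the value of the `i`-fold Pfister form
`⟨1, a 1⟩⊗⋯⊗⟨1, a i⟩` at the vector `(v 0, …, v (2^i − 1))`. -/
def pfisterVal {K : Type*} [Field K] (a : ℕ → K) : ℕ → (ℕ → K) → K
  | 0, v => v 0 ^ 2
  | (i + 1), v => pfisterVal a i v + a (i + 1) * pfisterVal a i (fun j => v (2 ^ i + j))

theorem div_aux {K : Type*} [Field K] (α q p : K) (h : p ≠ 0) :
    α * q / p * p ^ 2 = α * q * p := by
  field_simp

/-- Ring version of `pfisterVal`. -/
def pv {R : Type*} [CommRing R] (a : ℕ → R) : ℕ → (ℕ → R) → R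
  | 0, v => v 0 ^ 2
  | (i + 1), v => pv a i v + a (i + 1) * pv a i (fun j => v (2 ^ i + j))

theorem pfisterVal_eq_pv {K : Type*} [Field K] (a : ℕ → K) (i : ℕ) (v : ℕ → K) :
    pfisterVal a i v = pv a i v := by
  induction i generalizing v with
  | zero => rfl
  | succ i ih => simp only [pfisterVal, pv, ih]

theorem pv_map {R S : Type*} [CommRing R] [CommRing S] (f : R →+* S) (a : ℕ → R) (i : ℕ)
    (v : ℕ → R) : f (pv a i v) = pv (fun j => f (a j)) i (fun j => f (v j)) := by
  induction i generalizing v with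
  | zero => simp [pv]
  | succ i ih => simp only [pv, map_add, map_mul, ih]

theorem pv_congr {R : Type*} [CommRing R] (a : ℕ → R) (i : ℕ) (v w : ℕ → R)
    (h : ∀ j < 2 ^ i, v j = w j) : pv a i v = pv a i w := by
  induction i generalizing v w with
  | zero => simp [pv, h 0 (by simp)]
  | succ i ih =>
    simp only [pv]
    rw [ih v w (fun j hj => h j (by rw [pow_succ]; omega)),
      ih _ (fun j => w (2 ^ i + j)) (fun j hj => h _ (by rw [pow_succ]; omega))]

theorem pv_zero {R : Type*} [CommRing R] (a : ℕ → R) (i : ℕ) :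
    pv a i (fun _ => 0) = 0 := by
  induction i with
  | zero => simp [pv]
  | succ i ih => simp [pv, ih]

theorem pv_pad {R : Type*} [CommRing R] (a : ℕ → R) (i m : ℕ) (him : i ≤ m) (v : ℕ → R)
    (h : ∀ j, 2 ^ i ≤ j → v j = 0) : pv a m v = pv a i v := by
  induction m, him using Nat.le_induction with
  | base => rfl
  | succ m him ih =>
    have : (fun j => v (2 ^ m + j)) = fun _ => 0 := by
      funext j
      apply h
      have := Nat.pow_le_pow_right (n := 2) (by norm_num) him
      omega
    simp only [pv]
    rw [this, pv_zero, ih]; simp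

theorem pv_one {R : Type*} [CommRing R] (a : ℕ → R) (m : ℕ) (v : ℕ → R)
    (h0 : v 0 = 1) (h : ∀ j, 1 ≤ j → v j = 0) : pv a m v = 1 := by
  rw [pv_pad a 0 m (Nat.zero_le _) v (by simpa using h)]
  simp [pv, h0]

theorem pv_two {R : Type*} [CommRing R] (a : ℕ → R) (m : ℕ) (hm : 1 ≤ m) (v : ℕ → R)
    (h : ∀ j, 2 ≤ j → v j = 0) : pv a m v = v 0 ^ 2 + a 1 * v 1 ^ 2 := by
  rw [pv_pad a 1 m hm v (by simpa using h)]
  simp [pv]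

theorem pv_basis {R : Type*} [CommRing R] (a : ℕ → R) (i m : ℕ) (him : i + 1 ≤ m) :
    pv a m (fun j => if j = 2 ^ i then 1 else 0) = a (i + 1) := by
  rw [pv_pad a (i+1) m him]
  · simp only [pv]
    rw [pv_congr a i _ (fun _ => 0), pv_zero, pv_one]
    · simp
    · simp
    · intro j hj
      simp; omega
    · intro j hj
      simp; omega
  · intro j hj
    have : 0 < 2 ^ i := by positivity
    rw [pow_succ] at hj
    simp; omega

theorem poly_not_sq {R : Type*} [CommRing R] [IsDomain R] (h2 : (2 : R) ≠ 0) (c b : R)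
    (hc : c ≠ 0) (hb : b ≠ 0) (p : Polynomial R)
    (h : p ^ 2 = Polynomial.C c * (Polynomial.X ^ 2 + Polynomial.C b)) : False := by
  have hd : p.natDegree ≤ 1 := by
    have := congrArg Polynomial.natDegree h
    rw [Polynomial.natDegree_pow, Polynomial.natDegree_C_mul hc,
      Polynomial.natDegree_X_pow_add_C] at this
    omega
  obtain ⟨u, v, rfl⟩ := Polynomial.exists_eq_X_add_C_of_natDegree_le_one hd
  have e0 := congrArg (Polynomial.eval 0) h
  have e1 := congrArg (Polynomial.eval 1) h
  have e2 := congrArg (Polynomial.eval (-1)) h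
  simp at e0 e1 e2
  have h4 : 2 * 2 * (u * v) = 0 := by linear_combination e1 - e2
  have huv : u * v = 0 := by simpa [h2] using h4
  have hu : u ^ 2 = c := by
    have : 2 * (u ^ 2 - c) = 0 := by linear_combination e1 + e2 - 2 * e0
    have := (mul_eq_zero.1 this).resolve_left h2
    linear_combination this
  rcases mul_eq_zero.1 huv with h | h
  · subst h; apply hc; rw [← hu]; simp
  · subst h
    have : c * b = 0 := by linear_combination -e0
    exact (mul_ne_zero hc hb) this

theorem core (F : Type*) [Field F] (h2 : (1 : F) + 1 ≠ 0)
    (n : ℕ) (hn : 1 ≤ n) (a : ℕ → F) (hsq : ∀ y : F, y ^ 2 ≠ - a 1)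
    (hne : ∀ i ∈ Finset.Icc 1 n, a i ≠ 0) 
    (x : ℕ → MvPolynomial (Fin (2 ^ n)) F)
    (hx : x = fun j => if h : j < 2 ^ n then MvPolynomial.X ⟨j, h⟩ else 0)
    (P Q : ℕ → MvPolynomial (Fin (2 ^ n)) F)
    (hP : P = fun i => pv (fun i => MvPolynomial.C (a i)) i x)
    (hQ : Q = fun i => pv (fun i => MvPolynomial.C (a i)) i (fun j => x (2 ^ i + j)))
    (hPne : ∀ i < n, P i ≠ 0) (hQne : ∀ i < n, Q i ≠ 0)
    (S : Finset ℕ) (hS : S ⊆ Finset.Icc 1 n) (hS' : S.Nonempty)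
    (p : MvPolynomial (Fin (2 ^ n)) F)
    (hp : p ^ 2 = ∏ i ∈ S, (if i = 1 then - MvPolynomial.C (a 1) else
      - MvPolynomial.C (a i) * Q (i - 1) * P (i - 1))) : False := by
  set g : ℕ → MvPolynomial (Fin (2 ^ n)) F := fun i => (if i = 1 then - MvPolynomial.C (a 1) else
      - MvPolynomial.C (a i) * Q (i - 1) * P (i - 1)) with hg
  have hmS := S.max'_mem hS'
  have hle : ∀ i ∈ S, i ≤ S.max' hS' := fun i hi => S.le_max' i hi
  generalize S.max' hS' = m at hmS hle
  have hm := Finset.mem_Icc.1 (hS hmS)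
  rcases Nat.lt_or_ge 1 m with h1 | h1
  · -- main case
    obtain ⟨k, rfl⟩ : ∃ k, m = k + 1 := ⟨m - 1, by omega⟩
    have hk : 1 ≤ k := by omega
    have hpow : 2 ^ (k + 1) ≤ 2 ^ n := Nat.pow_le_pow_right (by norm_num) hm.2
    have hpk : 2 ≤ 2 ^ k := by
      simpa using Nat.pow_le_pow_right (n := 2) (by norm_num) hk
    rw [pow_succ] at hpow
    rw [← Finset.mul_prod_erase S _ hmS] at hp
    let T : Fin (2 ^ n) → Polynomial (MvPolynomial (Fin (2 ^ n)) F) := fun j =>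
      if (j : ℕ) < 2 ^ k then Polynomial.C (MvPolynomial.X j) else
      if (j : ℕ) = 2 ^ k then Polynomial.X else if (j : ℕ) = 2 ^ k + 1 then 1 else 0
    let θ : MvPolynomial (Fin (2 ^ n)) F →+* Polynomial (MvPolynomial (Fin (2 ^ n)) F) :=
      MvPolynomial.eval₂Hom (Polynomial.C.comp MvPolynomial.C) T
    have θC : ∀ c : F, θ (MvPolynomial.C c) = Polynomial.C (MvPolynomial.C c) := by
      intro c; simp [θ]
    have θx : ∀ j < 2 ^ k, θ (x j) = Polynomial.C (x j) := by
      intro j hj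
      have : j < 2 ^ n := by omega
      simp [hx, this, θ, T, hj]
    have θP : ∀ i ≤ k, θ (P i) = Polynomial.C (P i) := by
      intro i hi
      have := Nat.pow_le_pow_right (n := 2) (by norm_num) hi
      simp only [hP]
      rw [pv_map, pv_map]
      simp only [θC]
      exact pv_congr _ _ _ _ fun j hj => θx j (by omega)
    have θQ : ∀ i < k, θ (Q i) = Polynomial.C (Q i) := by
      intro i hi
      have := Nat.pow_le_pow_right (n := 2) (by norm_num) (Nat.succ_le_of_lt hi)
      rw [Nat.succ_eq_add_one, pow_succ] at this
      simp only [hQ]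
      rw [pv_map, pv_map]
      simp only [θC]
      exact pv_congr _ _ _ _ fun j hj => θx _ (by omega)
    have θQk : θ (Q k) = Polynomial.X ^ 2 + Polynomial.C (MvPolynomial.C (a 1)) := by
      simp only [hQ]
      rw [pv_map, pv_two _ _ hk]
      · have h1 : 2 ^ k < 2 ^ n := by omega
        have h2 : 2 ^ k + 1 < 2 ^ n := by omega
        simp [hx, h1, h2, θ, T]
      · intro j hj
        by_cases h : 2 ^ k + j < 2 ^ n
        · have h3 : j ≠ 0 := by omega
          have h4 : j ≠ 1 := by omega
          simp [hx, h, θ, T, h3, h4]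
        · simp [hx, h]
    have θg : ∀ i ∈ S.erase (k + 1), θ (g i) = Polynomial.C (g i) := by
      intro i hi
      have hi' := Finset.mem_erase.1 hi
      have := hle i hi'.2
      have h5 := Finset.mem_Icc.1 (hS hi'.2)
      simp only [hg]
      split_ifs with h
      · simp [θC]
      · simp only [map_mul, map_neg, θC]
        rw [θP _ (by omega), θQ _ (by omega)]
    have gne : ∀ i ∈ S, g i ≠ 0 := by
      intro i hi
      have h5 := Finset.mem_Icc.1 (hS hi)
      simp only [hg]
      split_ifs with h
      · simpa using hne 1 (by simpa using hn)
      · refine mul_ne_zero (mul_ne_zero ?_ (hQne _ (by omega))) (hPne _ (by omega))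
        simpa using hne i (hS hi)
    have key := congrArg θ hp
    rw [map_pow, map_mul, map_prod, Finset.prod_congr rfl θg, ← map_prod] at key
    have gk : θ (g (k + 1)) = Polynomial.C (- MvPolynomial.C (a (k + 1)) * P k) *
        (Polynomial.X ^ 2 + Polynomial.C (MvPolynomial.C (a 1))) := by
      have : k + 1 ≠ 1 := by omega
      simp only [hg, this, if_false, Nat.add_sub_cancel, map_mul, map_neg, θC, θQk, θP k le_rfl]
      ring
    refine poly_not_sq (R := MvPolynomial (Fin (2 ^ n)) F) ?_
      (- MvPolynomial.C (a (k + 1)) * P k * ∏ i ∈ S.erase (k + 1), g i)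
      (MvPolynomial.C (a 1)) ?_ ?_ (θ p) ?_
    · intro h
      have := congrArg (MvPolynomial.eval (fun _ => (0 : F))) h
      apply h2
      simp only [← one_add_one_eq_two] at this
      simpa only [map_add, map_one, map_zero] using this
    · refine mul_ne_zero (mul_ne_zero ?_ (hPne _ (by omega))) ?_
      · simpa using hne _ (hS hmS)
      · exact Finset.prod_ne_zero_iff.2 fun i hi => gne i (Finset.mem_of_mem_erase hi)
    · simpa using hne 1 (by simpa using hn)
    · rw [key, gk, map_mul Polynomial.C (- MvPolynomial.C (a (k + 1)) * P k)]
      ring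
  · have hS1 : S = {1} := by
      ext i
      simp only [Finset.mem_singleton]
      constructor
      · intro hi
        have := hle i hi
        have := Finset.mem_Icc.1 (hS hi)
        omega
      · rintro rfl
        have : m = 1 := by omega
        exact this ▸ hmS
    subst hS1
    have := congrArg (MvPolynomial.eval (fun _ => (0 : F))) hp
    simp [hg] at this
    exact hsq _ this


/-- If `φ = ⟨1,a₁⟩⊗⋯⊗⟨1,aₙ⟩` is anisotropic over `F` and `K = F(X₁,…,X_{2ⁿ})`, then the
elements `−a₁, −a₂ψ̂₁/ψ₁, …, −aₙψ̂_{n−1}/ψ_{n−1}` are independent modulo squares in `K`: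
no product of a nonempty subset of them is a square, so they generate a multiquadratic
extension `L` of `K` of degree `2ⁿ`. -/
theorem stmt_13 (F : Type*) [Field F] (h2 : (1 : F) + 1 ≠ 0)
    (n : ℕ) (hn : 1 ≤ n) (a : ℕ → F)
    (haniso : ∀ v : Fin (2 ^ n) → F,
      pfisterVal a n (fun j => if h : j < 2 ^ n then v ⟨j, h⟩ else 0) = 0 → v = 0) :
    let K := FractionRing (MvPolynomial (Fin (2 ^ n)) F)
    let X : ℕ → K := fun j =>
      if h : j < 2 ^ n then
        algebraMap (MvPolynomial (Fin (2 ^ n)) F) K (MvPolynomial.X ⟨j, h⟩)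
      else 0
    let A : ℕ → K := fun i => algebraMap F K (a i)
    let ψ : ℕ → K := fun i => pfisterVal A i X
    let ψhat : ℕ → K := fun i => pfisterVal A i (fun j => X (2 ^ i + j))
    let d : ℕ → K := fun i => if i = 1 then -A 1 else -A i * ψhat (i - 1) / ψ (i - 1)
    ∀ S : Finset ℕ, S ⊆ Finset.Icc 1 n → S.Nonempty →
      ∀ y : K, y ^ 2 ≠ ∏ i ∈ S, d i := by
  intro K X A ψ ψhat d S hS hS' y hy
  have hsq : ∀ y : F, y ^ 2 ≠ - a 1 := by
    intro y hy
    have hpow : 2 ≤ 2 ^ n := by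
      simpa using Nat.pow_le_pow_right (n := 2) (by norm_num) hn
    have := haniso (fun j => if (j : ℕ) = 0 then y else if (j : ℕ) = 1 then 1 else 0) (by
      rw [pfisterVal_eq_pv, pv_two _ _ hn]
      · have h0 : 0 < 2 ^ n := by omega
        have h1 : 1 < 2 ^ n := by omega
        simp only [h0, h1, dif_pos]
        simp [hy]
      · intro j hj
        have h3 : j ≠ 0 := by omega
        have h4 : j ≠ 1 := by omega
        simp [h3, h4])
    have := congrFun this ⟨1, by omega⟩
    simp at this
  have hne : ∀ i ∈ Finset.Icc 1 n, a i ≠ 0 := by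
    intro i hi h0
    obtain ⟨hi1, hi2⟩ := Finset.mem_Icc.1 hi
    obtain ⟨k, rfl⟩ : ∃ k, i = k + 1 := ⟨i - 1, by omega⟩
    have hpow : 2 ^ k < 2 ^ n := Nat.pow_lt_pow_right (by norm_num) (by omega)
    have := haniso (fun j => if (j : ℕ) = 2 ^ k then 1 else 0) (by
      rw [pfisterVal_eq_pv]
      refine Eq.trans ?_ ((pv_basis a k n hi2).trans h0)
      apply pv_congr
      intro j hj
      simp [hj])
    have := congrFun this ⟨2 ^ k, hpow⟩
    simp at this
  let x : ℕ → MvPolynomial (Fin (2 ^ n)) F :=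
    fun j => if h : j < 2 ^ n then MvPolynomial.X ⟨j, h⟩ else 0
  let P : ℕ → MvPolynomial (Fin (2 ^ n)) F :=
    fun i => pv (fun i => MvPolynomial.C (a i)) i x
  let Q : ℕ → MvPolynomial (Fin (2 ^ n)) F :=
    fun i => pv (fun i => MvPolynomial.C (a i)) i (fun j => x (2 ^ i + j))
  have hPne : ∀ i < n, P i ≠ 0 := by
    intro i hi h
    have := congrArg (MvPolynomial.eval (fun j : Fin (2 ^ n) => if (j : ℕ) = 0 then (1 : F) else 0)) h
    simp only [P] at this
    rw [pv_map, pv_one] at this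
    · simp at this
    · simp [x]
    · intro j hj
      have : j ≠ 0 := by omega
      by_cases h : j < 2 ^ n
      · simp [x, h, this]
      · simp [x, h]
  have hQne : ∀ i < n, Q i ≠ 0 := by
    intro i hi h
    have hpow : 2 ^ i < 2 ^ n := Nat.pow_lt_pow_right (by norm_num) hi
    have := congrArg (MvPolynomial.eval (fun j : Fin (2 ^ n) => if (j : ℕ) = 2 ^ i then (1 : F) else 0)) h
    simp only [Q] at this
    rw [pv_map, pv_one] at this
    · simp at this
    · simp [x, hpow]
    · intro j hj
      have : j ≠ 0 := by omega
      by_cases h : 2 ^ i + j < 2 ^ n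
      · simp [x, h, this]
      · simp [x, h]
  let ι := algebraMap (MvPolynomial (Fin (2 ^ n)) F) K
  have hι : Function.Injective ι := IsFractionRing.injective _ _
  have hA : ∀ i, A i = ι (MvPolynomial.C (a i)) := fun i =>
    IsScalarTower.algebraMap_apply F (MvPolynomial (Fin (2 ^ n)) F) K (a i)
  have hX : ∀ j, X j = ι (x j) := by
    intro j
    by_cases h : j < 2 ^ n
    · simp [X, x, h, ι]
    · simp [X, x, h]
  have hψ : ∀ i, ψ i = ι (P i) := by
    intro i
    simp only [ψ, P]
    rw [pfisterVal_eq_pv, pv_map]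
    simp only [← hA, ← hX]
  have hψhat : ∀ i, ψhat i = ι (Q i) := by
    intro i
    simp only [ψhat, Q]
    rw [pfisterVal_eq_pv, pv_map]
    simp only [← hA, ← hX]
  let s : ℕ → K := fun i => if i = 1 then 1 else ι (P (i - 1))
  let g : ℕ → MvPolynomial (Fin (2 ^ n)) F := fun i =>
    if i = 1 then - MvPolynomial.C (a 1) else - MvPolynomial.C (a i) * Q (i - 1) * P (i - 1)
  have hd : ∀ i ∈ S, d i * s i ^ 2 = ι (g i) := by
    intro i hi
    have h5 := Finset.mem_Icc.1 (hS hi)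
    by_cases h : i = 1
    · simp [d, s, g, h, hA]
    · have hz : ι (P (i - 1)) ≠ 0 := by
        rw [Ne, map_eq_zero_iff ι hι]
        exact hPne _ (by omega)
      simp only [d, s, g, h, if_false, hψ, hψhat, hA, map_mul, map_neg]
      exact div_aux _ _ _ hz
  have hy2 : (y * ∏ i ∈ S, s i) ^ 2 = ι (∏ i ∈ S, g i) := by
    rw [mul_pow, hy, ← Finset.prod_pow, ← Finset.prod_mul_distrib, map_prod]
    exact Finset.prod_congr rfl hd
  obtain ⟨p, hp⟩ := IsIntegrallyClosed.exists_algebraMap_eq_of_isIntegral_pow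
    (R := MvPolynomial (Fin (2 ^ n)) F) (K := K) (x := y * ∏ i ∈ S, s i) (n := 2) (by norm_num)
    (by rw [hy2]; exact isIntegral_algebraMap)
  refine core F h2 n hn a hsq hne x rfl P Q rfl rfl hPne hQne S hS hS' p ?_
  apply hι
  rw [map_pow, ← hy2]
  exact congrArg (· ^ 2) hp
end
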